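/- arXiv:2506.18865 — 2 statements merged into one kernel-verified Lean document; each statement's English description precedes it below -/
import Mathlib

section
/- Let (x_j)_{j∈J} be a frame for H with frame bounds 0 < A ≤ B and frame operator S. Fix x ∈ H. Define y₀ = 0 and, for n ≥ 0, set α_n = ‖S(x − y_n)‖² / ‖S(x − y_n)‖_S² (if S(x − y_n) ≠ 0; if x = y_n the iteration is stationary) and y_{n+1} = y_n + α_n·S(x − y_n). Then y_n converges to x as n → ∞, and for every n ≥ 0, ‖x − y_n‖_S ≤ ((B − A)/(B + A))^n · ‖x‖_S. -/
noncomputable section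

local notation "⟪" x ", " y "⟫" => @inner ℝ _ _ x y

section FrameOperator

variable {H : Type*} [NormedAddCommGroup H] [InnerProductSpace ℝ H] {J : Type*}

/-- A lower frame bound forces the series of squared frame coefficients to converge. -/
lemma summable_sq_inner_of_lower_bound {f : J → H} {A : ℝ} (hA : 0 < A)
    (hf : ∀ x : H, A * ‖x‖ ^ 2 ≤ ∑' j, ⟪x, f j⟫ ^ 2) (x : H) :
    Summable fun j => ⟪x, f j⟫ ^ 2 := by
  by_contra h
  have h1 := hf x
  rw [tsum_eq_zero_of_not_summable h] at h1
  have hx : ‖x‖ ^ 2 = 0 := by nlinarith [sq_nonneg ‖x‖]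
  obtain rfl : x = 0 := by simpa using hx
  simp at h

/-- The synthesis operator of a Bessel family is bounded on finitely supported sequences. -/
lemma norm_sum_smul_sq_le {f : J → H} {B : ℝ} (hB : 0 ≤ B)
    (hsum : ∀ x : H, Summable fun j => ⟪x, f j⟫ ^ 2)
    (hf : ∀ x : H, ∑' j, ⟪x, f j⟫ ^ 2 ≤ B * ‖x‖ ^ 2) (c : J → ℝ) (s : Finset J) :
    ‖∑ j ∈ s, c j • f j‖ ^ 2 ≤ B * ∑ j ∈ s, c j ^ 2 := by
  set v := ∑ j ∈ s, c j • f j with hv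
  have h1 : ‖v‖ ^ 2 = ∑ j ∈ s, c j * ⟪v, f j⟫ := by
    rw [← real_inner_self_eq_norm_sq]
    nth_rewrite 2 [hv]
    simp only [inner_sum, inner_smul_right]
  have h2 := Finset.sum_mul_sq_le_sq_mul_sq s c fun j => ⟪v, f j⟫
  have h3 : ∑ j ∈ s, ⟪v, f j⟫ ^ 2 ≤ B * ‖v‖ ^ 2 :=
    ((hsum v).sum_le_tsum s fun _ _ => sq_nonneg _).trans (hf v)
  have h4 : 0 ≤ ∑ j ∈ s, c j ^ 2 := Finset.sum_nonneg fun _ _ => sq_nonneg _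
  rw [← h1] at h2
  have h5 : ‖v‖ ^ 2 * ‖v‖ ^ 2 ≤ (B * ∑ j ∈ s, c j ^ 2) * ‖v‖ ^ 2 := by
    nlinarith [mul_le_mul_of_nonneg_left h3 h4]
  rcases eq_or_ne v 0 with h0 | h0
  · rw [h0, norm_zero, zero_pow two_ne_zero]
    positivity
  · exact le_of_mul_le_mul_right h5 (by positivity)

/-- The frame operator series of a Bessel family converges unconditionally. -/
lemma summable_inner_smul [CompleteSpace H] {f : J → H} {B : ℝ} (hB : 0 < B)
    (hsum : ∀ x : H, Summable fun j => ⟪x, f j⟫ ^ 2)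
    (hf : ∀ x : H, ∑' j, ⟪x, f j⟫ ^ 2 ≤ B * ‖x‖ ^ 2) (x : H) :
    Summable fun j => ⟪x, f j⟫ • f j := by
  rw [summable_iff_vanishing_norm]
  intro ε hε
  obtain ⟨s, hs⟩ := summable_iff_vanishing_norm.1 (hsum x) (ε ^ 2 / B) (by positivity)
  refine ⟨s, fun t ht => lt_of_pow_lt_pow_left₀ 2 hε.le ?_⟩
  refine (norm_sum_smul_sq_le hB.le hsum hf _ t).trans_lt ?_
  rw [← lt_div_iff₀' hB]
  exact (le_abs_self _).trans_lt (hs t ht)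

/-- For a symmetric operator `S` with `A ≤ S ≤ B`, the operator `S (S - A) (B - S)` is positive. -/
lemma mul_inner_map_self_le {S : H →L[ℝ] H} {A B : ℝ} (hA : 0 < A) (hAB : A ≤ B)
    (hsymm : (S : H →ₗ[ℝ] H).IsSymmetric)
    (hlow : ∀ x, A * ‖x‖ ^ 2 ≤ ⟪S x, x⟫) (hupp : ∀ x, ⟪S x, x⟫ ≤ B * ‖x‖ ^ 2) (e : H) :
    A * B * ⟪S e, e⟫ ≤ (A + B) * ‖S e‖ ^ 2 - ⟪S (S e), S e⟫ := by
  rcases hAB.eq_or_lt with rfl | hlt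
  · have hT : (S - A • ContinuousLinearMap.id ℝ H : H →L[ℝ] H) = 0 := by
      have hs : ((S - A • ContinuousLinearMap.id ℝ H : H →L[ℝ] H) : H →ₗ[ℝ] H).IsSymmetric := by
        intro u v
        have := hsymm u v
        simp only [ContinuousLinearMap.coe_coe] at this
        simp [inner_sub_left, inner_sub_right, inner_smul_left, inner_smul_right, this]
      have h0 := hs.inner_map_self_eq_zero.1 fun u => by
        have := le_antisymm (hupp u) (hlow u)
        simp [inner_sub_left, inner_smul_left, this]
      exact ContinuousLinearMap.coe_inj.1 h0
    have hS : ∀ u, S u = A • u := fun u => by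
      simpa [sub_eq_zero] using congrArg (fun T : H →L[ℝ] H => T u) hT
    simp only [hS, inner_smul_left, inner_smul_right, norm_smul, real_inner_self_eq_norm_sq,
      Real.norm_eq_abs, mul_pow, sq_abs, conj_trivial]
    apply le_of_eq
    ring
  · have h1 := hlow (S e - B • e)
    have h2 := hupp (S e - A • e)
    have hs : ⟪S (S e), e⟫ = ⟪S e, S e⟫ := hsymm (S e) e
    simp only [← real_inner_self_eq_norm_sq, map_sub, map_smul, inner_sub_left, inner_sub_right,
      inner_smul_left, inner_smul_right, conj_trivial, hs, real_inner_comm (S e) e] at h1 h2 ⊢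
    have hB : 0 < B := hA.trans hlt
    nlinarith [mul_le_mul_of_nonneg_left h1 hA.le, mul_le_mul_of_nonneg_left h2 hB.le,
      sub_pos.2 hlt]

/-- One step of steepest descent contracts the energy by the factor `((B - A) / (B + A)) ^ 2`. -/
lemma inner_map_self_steepest_descent_le {S : H →L[ℝ] H} {A B : ℝ} (hA : 0 < A) (hAB : A ≤ B)
    (hsymm : (S : H →ₗ[ℝ] H).IsSymmetric)
    (hlow : ∀ x, A * ‖x‖ ^ 2 ≤ ⟪S x, x⟫) (hupp : ∀ x, ⟪S x, x⟫ ≤ B * ‖x‖ ^ 2) {e e' : H}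
    (he : e' = e - (‖S e‖ ^ 2 / ⟪S (S e), S e⟫) • S e) :
    ⟪S e', e'⟫ ≤ ((B - A) / (B + A)) ^ 2 * ⟪S e, e⟫ := by
  have hK := mul_inner_map_self_le hA hAB hsymm hlow hupp e
  rcases eq_or_ne (S e) 0 with h0 | h0
  · subst he
    simp [h0]
  have hd : 0 < ⟪S (S e), S e⟫ := lt_of_lt_of_le (by positivity) (hlow (S e))
  have hs : ⟪S (S e), e⟫ = ‖S e‖ ^ 2 :=
    (hsymm (S e) e).trans (real_inner_self_eq_norm_sq _)
  have hE : ⟪S e', e'⟫ = ⟪S e, e⟫ - (‖S e‖ ^ 2) ^ 2 / ⟪S (S e), S e⟫ := by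
    subst he
    simp only [map_sub, map_smul, inner_sub_left, inner_sub_right, inner_smul_left,
      inner_smul_right, conj_trivial, hs, real_inner_self_eq_norm_sq]
    field_simp
    ring
  rw [hE]
  generalize ⟪S (S e), S e⟫ = d at *
  generalize ‖S e‖ ^ 2 = r at *
  generalize ⟪S e, e⟫ = E at *
  have hAB' : 0 < B + A := by linarith
  have hr : r ^ 2 / d ≥ 4 / (B + A) * r - 4 / (B + A) ^ 2 * d := by
    have : r ^ 2 / d - (4 / (B + A) * r - 4 / (B + A) ^ 2 * d) =
        (r - 2 / (B + A) * d) ^ 2 / d := by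
      field_simp
      ring
    have : 0 ≤ (r - 2 / (B + A) * d) ^ 2 / d := by positivity
    linarith
  have hq : ((B - A) / (B + A)) ^ 2 * E =
      E - 4 / (B + A) ^ 2 * (A * B * E) := by
    field_simp
    ring
  have hm := mul_le_mul_of_nonneg_left hK (show 0 ≤ 4 / (B + A) ^ 2 by positivity)
  have : 4 / (B + A) ^ 2 * ((A + B) * r - d) = 4 / (B + A) * r - 4 / (B + A) ^ 2 * d := by
    field_simp
    ring
  linarith

end FrameOperator

/-- **The Greedy Frame Algorithm.**  Let `(xj j)_{j ∈ J}` be a frame for `H` with bounds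
`0 < A ≤ B` and frame operator `S`.  Fix `x ∈ H`, let `y 0 = 0` and
`y (n+1) = y n + αₙ • S (x - y n)` with `αₙ = ‖S (x - y n)‖ ^ 2 / ‖S (x - y n)‖_S ^ 2`
(note `‖e‖_S ^ 2 = ⟪S e, e⟫`, so `αₙ = ‖S e‖ ^ 2 / ⟪S (S e), S e⟫`; when `x = y n` the
quotient is `0/0 = 0` and the iteration is stationary).  Then `y n → x` and
`‖x - y n‖_S ≤ ((B - A) / (B + A)) ^ n * ‖x‖_S`. -/
theorem greedy_frame_algorithm
    {H : Type*} [NormedAddCommGroup H] [InnerProductSpace ℝ H] [CompleteSpace H]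
    {J : Type*} [Countable J] (xj : J → H)
    (A B : ℝ) (hA : 0 < A) (hAB : A ≤ B)
    (hframe : ∀ x : H,
      A * ‖x‖ ^ 2 ≤ ∑' j, ⟪x, xj j⟫ ^ 2 ∧ ∑' j, ⟪x, xj j⟫ ^ 2 ≤ B * ‖x‖ ^ 2)
    (S : H →L[ℝ] H) (hS : ∀ x : H, S x = ∑' j, ⟪x, xj j⟫ • xj j)
    (x : H) (y : ℕ → H) (hy0 : y 0 = 0)
    (hy : ∀ n : ℕ, y (n + 1) = y n +
      (‖S (x - y n)‖ ^ 2 / ⟪S (S (x - y n)), S (x - y n)⟫) • S (x - y n)) :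
    Filter.Tendsto y Filter.atTop (nhds x) ∧
      ∀ n : ℕ, Real.sqrt ⟪S (x - y n), x - y n⟫ ≤
        ((B - A) / (B + A)) ^ n * Real.sqrt ⟪S x, x⟫ := by
  have hB : 0 < B := hA.trans_le hAB
  have hsum := summable_sq_inner_of_lower_bound hA fun u => (hframe u).1
  have hinner : ∀ u v : H, ⟪S u, v⟫ = ∑' j, ⟪u, xj j⟫ * ⟪v, xj j⟫ := fun u v => by
    have h := (summable_inner_smul hB hsum (fun w => (hframe w).2) u).hasSum
    rw [← hS u] at h
    rw [real_inner_comm]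
    simpa [inner_smul_right] using ((innerSL ℝ v).hasSum h).tsum_eq.symm
  have hsymm : (S : H →ₗ[ℝ] H).IsSymmetric := fun u v => by
    simp only [ContinuousLinearMap.coe_coe]
    rw [hinner, ← real_inner_comm, hinner]
    simp only [mul_comm]
  have hself : ∀ u : H, ⟪S u, u⟫ = ∑' j, ⟪u, xj j⟫ ^ 2 := fun u => by
    simp only [hinner, pow_two]
  have hlow : ∀ u, A * ‖u‖ ^ 2 ≤ ⟪S u, u⟫ := fun u => hself u ▸ (hframe u).1
  have hupp : ∀ u, ⟪S u, u⟫ ≤ B * ‖u‖ ^ 2 := fun u => hself u ▸ (hframe u).2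
  set q := (B - A) / (B + A) with hq
  have hq0 : 0 ≤ q := div_nonneg (by linarith) (by linarith)
  have hq1 : q < 1 := by rw [hq, div_lt_one (by linarith)]; linarith
  have hbound : ∀ n, ⟪S (x - y n), x - y n⟫ ≤ (q ^ n) ^ 2 * ⟪S x, x⟫ := by
    intro n
    induction n with
    | zero => simp [hy0]
    | succ n ih =>
      have hstep := inner_map_self_steepest_descent_le (e' := x - y (n + 1)) hA hAB hsymm hlow hupp
        (show _ = x - y n - _ by rw [hy n, sub_add_eq_sub_sub])
      calc _ ≤ q ^ 2 * ⟪S (x - y n), x - y n⟫ := hstep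
        _ ≤ q ^ 2 * ((q ^ n) ^ 2 * ⟪S x, x⟫) := by gcongr
        _ = (q ^ (n + 1)) ^ 2 * ⟪S x, x⟫ := by ring
  refine ⟨?_, fun n => ?_⟩
  · rw [tendsto_iff_norm_sub_tendsto_zero]
    have hlim : Filter.Tendsto (fun n => (q ^ n) ^ 2 * ⟪S x, x⟫ / A) Filter.atTop (nhds 0) := by
      simpa using (((tendsto_pow_atTop_nhds_zero_of_lt_one hq0 hq1).pow 2).mul_const
        ⟪S x, x⟫).div_const A
    have hsq : Filter.Tendsto (fun n => ‖y n - x‖ ^ 2) Filter.atTop (nhds 0) := by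
      refine squeeze_zero (fun _ => by positivity) (fun n => ?_) hlim
      rw [le_div_iff₀' hA, norm_sub_rev]
      exact (hlow _).trans (hbound n)
    simpa using hsq.sqrt
  · rw [← Real.sqrt_sq (pow_nonneg hq0 n), ← Real.sqrt_mul (sq_nonneg _)]
    exact Real.sqrt_le_sqrt (hbound n)
end
end

section
/- Let (x_j)_{j∈J} be a frame for H with frame bounds 0 < A ≤ B and frame operator S. Fix x ∈ H. Define y₀ = 0 and, for n ≥ 0, set α_n = ‖x − y_n‖_S² / ‖S(x − y_n)‖² (if S(x − y_n) ≠ 0; if x = y_n the iteration is stationary) and y_{n+1} = y_n + α_n·S(x − y_n). Then y_n converges to x as n → ∞, and for every n ≥ 0, ‖x − y_n‖ ≤ ((B − A)/(B + A))^n · ‖x‖. -/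
noncomputable section

local notation "⟪" x ", " y "⟫" => @inner ℝ _ _ x y

/-- The norm of a finite synthesis sum of a Bessel family is controlled by its coefficients. -/
theorem norm_sq_sum_smul_le_of_bessel
    {H : Type*} [NormedAddCommGroup H] [InnerProductSpace ℝ H] {J : Type*} {v : J → H} {B : ℝ}
    (hB0 : 0 ≤ B)
    (hB : ∀ (x : H) (F : Finset J), ∑ j ∈ F, ⟪x, v j⟫ ^ 2 ≤ B * ‖x‖ ^ 2)
    (c : J → ℝ) (F : Finset J) :
    ‖∑ j ∈ F, c j • v j‖ ^ 2 ≤ B * ∑ j ∈ F, c j ^ 2 := by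
  set w := ∑ j ∈ F, c j • v j with hw
  have h1 : ‖w‖ ^ 2 = ∑ j ∈ F, c j * ⟪w, v j⟫ := by
    rw [← real_inner_self_eq_norm_sq]
    conv_lhs => rw [hw, inner_sum, ← hw]
    exact Finset.sum_congr rfl fun j _ => real_inner_smul_right _ _ _
  have h2 := Finset.sum_mul_sq_le_sq_mul_sq F c (fun j => ⟪w, v j⟫)
  rw [← h1] at h2
  have hc : 0 ≤ ∑ j ∈ F, c j ^ 2 := Finset.sum_nonneg fun j _ => sq_nonneg _
  have h3 := h2.trans (mul_le_mul_of_nonneg_left (hB w F) hc)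
  rcases eq_or_ne w 0 with h0 | h0
  · rw [h0]
    simpa using mul_nonneg hB0 hc
  · have hpos : 0 < ‖w‖ ^ 2 := by positivity
    refine le_of_mul_le_mul_right ?_ hpos
    nlinarith

/-- In a complete space, square-summable coefficients can be synthesized by a Bessel family. -/
theorem summable_smul_of_bessel
    {H : Type*} [NormedAddCommGroup H] [InnerProductSpace ℝ H] [CompleteSpace H]
    {J : Type*} {v : J → H} {B : ℝ} (hB0 : 0 < B)
    (hB : ∀ (x : H) (F : Finset J), ∑ j ∈ F, ⟪x, v j⟫ ^ 2 ≤ B * ‖x‖ ^ 2)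
    {c : J → ℝ} (hc : Summable fun j => c j ^ 2) : Summable fun j => c j • v j := by
  rw [summable_iff_vanishing_norm] at hc ⊢
  intro ε hε
  obtain ⟨s, hs⟩ := hc (ε ^ 2 / B) (by positivity)
  refine ⟨s, fun t ht => ?_⟩
  have h1 := (le_abs_self _).trans_lt (hs t ht)
  rw [lt_div_iff₀ hB0] at h1
  have h2 := norm_sq_sum_smul_le_of_bessel hB0.le hB c t
  exact lt_of_pow_lt_pow_left₀ 2 hε.le (by linarith)

/-- A symmetric positive operator dominated by `M` satisfies `T² ≤ M T`. -/
theorem norm_sq_apply_le_of_isSymmetric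
    {H : Type*} [NormedAddCommGroup H] [InnerProductSpace ℝ H] {T : H →ₗ[ℝ] H} {M : ℝ}
    (hT : T.IsSymmetric) (h0 : ∀ x, 0 ≤ ⟪T x, x⟫) (hM : ∀ x, ⟪T x, x⟫ ≤ M * ‖x‖ ^ 2) (x : H) :
    ‖T x‖ ^ 2 ≤ M * ⟪T x, x⟫ := by
  have hq : ∀ t : ℝ, 0 ≤ ⟪T (T x), T x⟫ * (t * t) + (2 * ‖T x‖ ^ 2) * t + ⟪T x, x⟫ := by
    intro t
    have h := h0 (x + t • T x)
    simp only [map_add, map_smul, inner_add_left, inner_add_right, real_inner_smul_left,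
      real_inner_smul_right] at h
    rw [hT (T x) x, real_inner_self_eq_norm_sq] at h
    linarith
  have hd := discrim_le_zero hq
  rw [discrim] at hd
  rcases (sq_nonneg ‖T x‖).eq_or_lt with hz | hz
  · rw [← hz]
    have hx : T x = 0 := by simpa using hz.symm
    simp [hx]
  · refine le_of_mul_le_mul_right ?_ hz
    nlinarith [mul_le_mul_of_nonneg_right (hM (T x)) (h0 x)]

/-- For a symmetric operator with `A ≤ S ≤ B`, one has `(S - A) (B - S) ≥ 0`. -/
theorem norm_sq_apply_add_le_of_isSymmetric
    {H : Type*} [NormedAddCommGroup H] [InnerProductSpace ℝ H] {S : H →ₗ[ℝ] H} {A B : ℝ}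
    (hS : S.IsSymmetric) (hA : ∀ x, A * ‖x‖ ^ 2 ≤ ⟪S x, x⟫) (hB : ∀ x, ⟪S x, x⟫ ≤ B * ‖x‖ ^ 2)
    (x : H) : ‖S x‖ ^ 2 + A * B * ‖x‖ ^ 2 ≤ (A + B) * ⟪S x, x⟫ := by
  have key : ∀ z, ⟪(S - A • LinearMap.id : H →ₗ[ℝ] H) z, z⟫ = ⟪S z, z⟫ - A * ‖z‖ ^ 2 := fun z => by
    simp [inner_sub_left, real_inner_smul_left]
  have h := norm_sq_apply_le_of_isSymmetric (T := S - A • LinearMap.id) (M := B - A)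
    (fun u w => by
      have := hS u w
      simp [inner_sub_left, inner_sub_right, real_inner_smul_left, real_inner_smul_right, this])
    (fun z => by rw [key]; linarith [hA z]) (fun z => by rw [key]; linarith [hB z]) x
  rw [key, LinearMap.sub_apply, norm_sub_sq_real] at h
  simp only [LinearMap.smul_apply, LinearMap.id_apply, real_inner_smul_right, norm_smul, mul_pow,
    Real.norm_eq_abs, sq_abs] at h
  linarith

/-- One step of the minimal residual iteration contracts the norm by `(B - A) / (B + A)`. -/
theorem norm_sub_smul_apply_le_of_isSymmetric
    {H : Type*} [NormedAddCommGroup H] [InnerProductSpace ℝ H] {S : H →ₗ[ℝ] H} {A B : ℝ}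
    (hA0 : 0 < A) (hAB : A ≤ B) (hS : S.IsSymmetric) (hA : ∀ x, A * ‖x‖ ^ 2 ≤ ⟪S x, x⟫)
    (hB : ∀ x, ⟪S x, x⟫ ≤ B * ‖x‖ ^ 2) (e : H) :
    ‖e - (⟪S e, e⟫ / ‖S e‖ ^ 2) • S e‖ ≤ (B - A) / (B + A) * ‖e‖ := by
  have hBA : 0 < B + A := by linarith
  have hr : 0 ≤ (B - A) / (B + A) := div_nonneg (by linarith) hBA.le
  rcases eq_or_ne (S e) 0 with h0 | h0
  · have h1 := hA e
    rw [h0, inner_zero_left] at h1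
    have he : ‖e‖ ^ 2 = 0 := le_antisymm (by nlinarith) (sq_nonneg _)
    have he' : e = 0 := by simpa using he
    simp [he']
  · have hq : 0 < ‖S e‖ ^ 2 := by positivity
    have h1 := norm_sq_apply_add_le_of_isSymmetric hS hA hB e
    refine (sq_le_sq₀ (norm_nonneg _) (mul_nonneg hr (norm_nonneg e))).1 ?_
    have hn : ‖e - (⟪S e, e⟫ / ‖S e‖ ^ 2) • S e‖ ^ 2 = ‖e‖ ^ 2 - ⟪S e, e⟫ ^ 2 / ‖S e‖ ^ 2 := by
      rw [norm_sub_sq_real, real_inner_smul_right, norm_smul, mul_pow, Real.norm_eq_abs, sq_abs,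
        real_inner_comm]
      field_simp
      ring
    have h2 : (‖S e‖ ^ 2 + A * B * ‖e‖ ^ 2) ^ 2 ≤ ((A + B) * ⟪S e, e⟫) ^ 2 :=
      pow_le_pow_left₀ (by have := hA0.trans_le hAB; positivity) h1 2
    have h3 : 4 * A * B / (B + A) ^ 2 * ‖e‖ ^ 2 ≤ ⟪S e, e⟫ ^ 2 / ‖S e‖ ^ 2 := by
      rw [div_mul_eq_mul_div, div_le_div_iff₀ (by positivity) hq]
      nlinarith [sq_nonneg (‖S e‖ ^ 2 - A * B * ‖e‖ ^ 2)]
    have h4 : ((B - A) / (B + A) * ‖e‖) ^ 2 = ‖e‖ ^ 2 - 4 * A * B / (B + A) ^ 2 * ‖e‖ ^ 2 := by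
      field_simp
      ring
    rw [hn, h4]
    linarith

/-- **Greedy frame algorithm in the standard norm.**  Let `(xj j)_{j ∈ J}` be a frame for
`H` with bounds `0 < A ≤ B` and frame operator `S`.  Fix `x ∈ H`, let `y 0 = 0` and
`y (n+1) = y n + αₙ • S (x - y n)` with `αₙ = ‖x - y n‖_S ^ 2 / ‖S (x - y n)‖ ^ 2`
(note `‖e‖_S ^ 2 = ⟪S e, e⟫`; when `x = y n` the quotient is `0/0 = 0` and the iteration
is stationary).  Then `y n → x` and `‖x - y n‖ ≤ ((B - A) / (B + A)) ^ n * ‖x‖`. -/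
theorem greedy_frame_algorithm_standard_norm
    {H : Type*} [NormedAddCommGroup H] [InnerProductSpace ℝ H] [CompleteSpace H]
    {J : Type*} [Countable J] (xj : J → H)
    (A B : ℝ) (hA : 0 < A) (hAB : A ≤ B)
    (hframe : ∀ x : H,
      A * ‖x‖ ^ 2 ≤ ∑' j, ⟪x, xj j⟫ ^ 2 ∧ ∑' j, ⟪x, xj j⟫ ^ 2 ≤ B * ‖x‖ ^ 2)
    (S : H →L[ℝ] H) (hS : ∀ x : H, S x = ∑' j, ⟪x, xj j⟫ • xj j)
    (x : H) (y : ℕ → H) (hy0 : y 0 = 0)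
    (hy : ∀ n : ℕ, y (n + 1) = y n +
      (⟪S (x - y n), x - y n⟫ / ‖S (x - y n)‖ ^ 2) • S (x - y n)) :
    Filter.Tendsto y Filter.atTop (nhds x) ∧
      ∀ n : ℕ, ‖x - y n‖ ≤ ((B - A) / (B + A)) ^ n * ‖x‖ := by
  have hB0 : 0 < B := hA.trans_le hAB
  have hsum : ∀ x : H, Summable fun j => ⟪x, xj j⟫ ^ 2 := fun x => by
    by_contra hns
    have h := (hframe x).1
    rw [tsum_eq_zero_of_not_summable hns] at h
    have hx : ‖x‖ ^ 2 = 0 := le_antisymm (by nlinarith) (sq_nonneg _)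
    have hx' : x = 0 := by simpa using hx
    exact hns (by simp [hx', summable_zero])
  have hbes : ∀ (x : H) (F : Finset J), ∑ j ∈ F, ⟪x, xj j⟫ ^ 2 ≤ B * ‖x‖ ^ 2 := fun x F =>
    ((hsum x).sum_le_tsum F fun j _ => sq_nonneg _).trans (hframe x).2
  have hSin : ∀ u w : H, ⟪S u, w⟫ = ∑' j, ⟪u, xj j⟫ * ⟪w, xj j⟫ := fun u w => by
    have h := (summable_smul_of_bessel hB0 hbes (hsum u)).hasSum
    rw [← hS u] at h
    have h' := (h.mapL (innerSL ℝ w)).tsum_eq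
    simp only [innerSL_apply_apply, real_inner_smul_right] at h'
    rw [real_inner_comm, ← h']
  have hdiag : ∀ u : H, ⟪S u, u⟫ = ∑' j, ⟪u, xj j⟫ ^ 2 := fun u => by
    simp only [hSin, sq]
  have hsymm : (S : H →ₗ[ℝ] H).IsSymmetric := fun u w => by
    change ⟪S u, w⟫ = ⟪u, S w⟫
    rw [real_inner_comm (S w) u, hSin, hSin]
    simp only [mul_comm]
  have hstep : ∀ e : H, ‖e - (⟪S e, e⟫ / ‖S e‖ ^ 2) • S e‖ ≤ (B - A) / (B + A) * ‖e‖ :=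
    norm_sub_smul_apply_le_of_isSymmetric hA hAB hsymm
      (fun u => (hframe u).1.trans_eq (hdiag u).symm)
      (fun u => (hdiag u).trans_le (hframe u).2)
  have hBA : 0 < B + A := by linarith
  have hr : 0 ≤ (B - A) / (B + A) := div_nonneg (by linarith) hBA.le
  have hr1 : (B - A) / (B + A) < 1 := (div_lt_one hBA).2 (by linarith)
  have hbound : ∀ n : ℕ, ‖x - y n‖ ≤ ((B - A) / (B + A)) ^ n * ‖x‖ := by
    intro n
    induction n with
    | zero => simp [hy0]
    | succ n ih =>
      rw [hy n, ← sub_sub, pow_succ' ((B - A) / (B + A)), mul_assoc]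
      exact (hstep _).trans (mul_le_mul_of_nonneg_left ih hr)
  refine ⟨?_, hbound⟩
  rw [tendsto_iff_norm_sub_tendsto_zero]
  refine squeeze_zero (fun n => norm_nonneg _)
    (fun n => (norm_sub_rev (y n) x).trans_le (hbound n)) ?_
  simpa using (tendsto_pow_atTop_nhds_zero_of_lt_one hr hr1).mul_const ‖x‖
end
end
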